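/- Let $t \le r \le s \le n$ and let $\mathcal{A} \subseteq \binom{X}{r}$ and $\mathcal{B} \subseteq \binom{X}{s}$ be cross $t$-intersecting families that are both shifted. Then $|A \cap B \cap [r+s-t]| \ge t$ for every $A \in \mathcal{A}$ and $B \in \mathcal{B}$. -/

import Mathlib

open Finset

/-- The shift `δ_{i,j}(F)`: replace `j` by `i` if `j ∈ F` and `i ∉ F`, else do nothing. -/
def shiftSet (i j : ℕ) (F : Finset ℕ) : Finset ℕ :=
  if j ∈ F ∧ i ∉ F then insert i (F.erase j) else F

/-- The shift operation `Δ_{i,j}` on a family of sets. -/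
def shiftFam (i j : ℕ) (𝒜 : Finset (Finset ℕ)) : Finset (Finset ℕ) :=
  𝒜.image (shiftSet i j) ∪ 𝒜.filter (fun F => shiftSet i j F ∈ 𝒜)

theorem stmt5 (n t r s : ℕ) (ht : 0 < t) (htr : t ≤ r) (hrs : r ≤ s) (hsn : s ≤ n)
    (𝒜 ℬ : Finset (Finset ℕ))
    (hA : 𝒜 ⊆ Finset.powersetCard r (Finset.Icc 1 n))
    (hB : ℬ ⊆ Finset.powersetCard s (Finset.Icc 1 n))
    (hAne : 𝒜.Nonempty) (hBne : ℬ.Nonempty)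
    (hcross : ∀ A ∈ 𝒜, ∀ B ∈ ℬ, t ≤ (A ∩ B).card)
    (hAsh : ∀ i ∈ Finset.Icc 1 n, ∀ j ∈ Finset.Icc 1 n, i < j → shiftFam i j 𝒜 = 𝒜)
    (hBsh : ∀ i ∈ Finset.Icc 1 n, ∀ j ∈ Finset.Icc 1 n, i < j → shiftFam i j ℬ = ℬ) :
    ∀ A ∈ 𝒜, ∀ B ∈ ℬ, t ≤ (A ∩ B ∩ Finset.Icc 1 (r + s - t)).card := by
  have main : ∀ k : ℕ, ∀ A ∈ 𝒜, ∀ B ∈ ℬ, (A ∩ B).card = k →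
      t ≤ (A ∩ B ∩ Finset.Icc 1 (r + s - t)).card := by
    intro k
    induction k with
    | zero =>
      intro A hAm B hBm hk
      have := hcross A hAm B hBm
      omega
    | succ k ih =>
      intro A hAm B hBm hk
      have hc := hcross A hAm B hBm
      obtain ⟨hAs, hAc⟩ := Finset.mem_powersetCard.1 (hA hAm)
      obtain ⟨hBs, hBc⟩ := Finset.mem_powersetCard.1 (hB hBm)
      by_cases hsub : A ∩ B ⊆ Finset.Icc 1 (r + s - t)
      · rwa [Finset.inter_eq_left.2 hsub]
      · obtain ⟨j, hj, hjm⟩ := Finset.not_subset.1 hsub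
        obtain ⟨hjA, hjB⟩ := Finset.mem_inter.1 hj
        have hj1 := Finset.mem_Icc.1 (hAs hjA)
        have hjm' : r + s - t < j := by
          by_contra hcon
          exact hjm (Finset.mem_Icc.2 ⟨hj1.1, by omega⟩)
        have hu := Finset.card_union_add_card_inter A B
        have hlt : ((A ∪ B).erase j).card < (Finset.Icc 1 (r + s - t)).card := by
          rw [Finset.card_erase_of_mem (Finset.mem_union_left _ hjA), Nat.card_Icc]
          omega
        obtain ⟨i, hi, hin⟩ := Finset.exists_mem_notMem_of_card_lt_card hlt
        have hi' := Finset.mem_Icc.1 hi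
        have hij : i < j := by omega
        have hiA : i ∉ A := fun h => hin (Finset.mem_erase.2 ⟨hij.ne, Finset.mem_union_left _ h⟩)
        have hiB : i ∉ B := fun h => hin (Finset.mem_erase.2 ⟨hij.ne, Finset.mem_union_right _ h⟩)
        have hA' : insert i (A.erase j) ∈ 𝒜 := by
          rw [← hAsh i (Finset.mem_Icc.2 ⟨hi'.1, by omega⟩) j (hAs hjA) hij]
          refine Finset.mem_union_left _ (Finset.mem_image.2 ⟨A, hAm, ?_⟩)
          simp [shiftSet, hjA, hiA]
        have e1 : insert i (A.erase j) ∩ B = (A ∩ B).erase j := by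
          rw [Finset.insert_inter_of_notMem hiB, Finset.erase_inter]
        have h := ih _ hA' B hBm (by rw [e1, Finset.card_erase_of_mem hj]; omega)
        rw [e1] at h
        exact h.trans (Finset.card_le_card
          (Finset.inter_subset_inter_right (Finset.erase_subset _ _)))
  intro A hAm B hBm
  exact main _ A hAm B hBm rfl
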